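/- arXiv:1407.5607 — 2 statements merged into one kernel-verified Lean document; each statement's English description precedes it below -/
import Mathlib

section
/- Let X be a nonempty compact metric space with diameter D which is antipodal: for every x ∈ X there exists a point O_x with d(x, O_x) = D and a surjective isometry (isometric equivalence) of X taking x to O_x. Let m be a Borel probability measure on X invariant under all isometric equivalences of X, and let A = ∫_{X×X} d(x,y) d(m×m)(x,y) be the average distance. Then D/2 ≤ A. -/
open MeasureTheory

section AverageDistance

variable {X : Type*} [MetricSpace X] [MeasurableSpace X] [BorelSpace X]

/-- On a compact metric space, the distance to a fixed point is integrable for any finite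
measure. -/
lemma integrable_dist_left_of_compactSpace [CompactSpace X] (m : Measure X)
    [IsFiniteMeasure m] (x : X) :
    Integrable (fun y => dist x y) m :=
  (continuous_const.dist continuous_id).integrable_of_hasCompactSupport
    (HasCompactSupport.of_compactSpace _)

/-- The mean distance to a point is unchanged by a measure-preserving isometry. -/
lemma integral_dist_isometryEquiv_apply (m : Measure X) (g : X ≃ᵢ X)
    (hg : Measure.map g m = m) (x : X) :
    ∫ y, dist (g x) y ∂m = ∫ y, dist x y ∂m := by
  conv_lhs => rw [← hg]
  rw [integral_map g.continuous.aemeasurable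
    (continuous_const.dist continuous_id').aestronglyMeasurable]
  exact integral_congr_ae (.of_forall fun y => g.dist_eq x y)

/-- The mean distances to two points add up to at least the distance between the points. -/
lemma dist_le_integral_dist_add_integral_dist [CompactSpace X] (m : Measure X)
    [IsProbabilityMeasure m]
    (x z : X) : dist x z ≤ ∫ y, dist x y ∂m + ∫ y, dist z y ∂m := by
  have hx := integrable_dist_left_of_compactSpace m x
  have hz := integrable_dist_left_of_compactSpace m z
  calc dist x z = ∫ _, dist x z ∂m := by simp
    _ ≤ ∫ y, (dist x y + dist z y) ∂m :=
        integral_mono (integrable_const _) (hx.add hz) fun y => dist_triangle_right x z y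
    _ = _ := integral_add hx hz

end AverageDistance

/-- In a nonempty compact antipodal metric space of diameter `D` with an
isometry-invariant Borel probability measure `m`, the average distance
`A = ∫_{X×X} d(x,y) d(m×m)` satisfies `D/2 ≤ A`. -/
theorem stmt_6 {X : Type*} [MetricSpace X] [CompactSpace X] [Nonempty X]
    [MeasurableSpace X] [BorelSpace X]
    (D : ℝ) (hD : D = Metric.diam (Set.univ : Set X))
    (hant : ∀ x : X, ∃ (Ox : X) (g : X ≃ᵢ X), dist x Ox = D ∧ g x = Ox)
    (m : Measure X) [IsProbabilityMeasure m]
    (hinv : ∀ g : X ≃ᵢ X, Measure.map g m = m)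
    (A : ℝ) (hA : A = ∫ p : X × X, dist p.1 p.2 ∂(m.prod m)) :
    D / 2 ≤ A := by
  have hint : Integrable (fun p : X × X => dist p.1 p.2) (m.prod m) :=
    continuous_dist.integrable_of_hasCompactSupport (HasCompactSupport.of_compactSpace _)
  have hmean (x : X) : D / 2 ≤ ∫ y, dist x y ∂m := by
    obtain ⟨_, g, hdist, rfl⟩ := hant x
    have h := dist_le_integral_dist_add_integral_dist m x (g x)
    rw [integral_dist_isometryEquiv_apply m g (hinv g) x, hdist] at h
    linarith
  rw [hA, integral_prod _ hint]
  calc D / 2 = ∫ _, D / 2 ∂m := by simp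
    _ ≤ ∫ x, ∫ y, dist x y ∂m ∂m :=
        integral_mono (integrable_const _) hint.integral_prod_left hmean
end

section
/- Let X be a nonempty compact homogeneous metric space with diameter D, let m be a Borel probability measure on X invariant under all isometric equivalences of X, and suppose the average distance A = ∫_{X×X} d(x,y) d(m×m)(x,y) satisfies A = D/2. Then X is strictly antipodal: for every x ∈ X there exists a point O_x with d(x, O_x) = D such that d(x,y) + d(y, O_x) = D for every y ∈ X. -/
open MeasureTheory

/-- On a compact homogeneous metric space, a nonzero isometry-invariant measure charges every
nonempty open set. -/
theorem isOpenPosMeasure_of_homogeneous {X : Type*} [MetricSpace X] [CompactSpace X]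
    [MeasurableSpace X] [BorelSpace X]
    (hhom : ∀ x y : X, ∃ g : X ≃ᵢ X, g x = y)
    (m : Measure X) [NeZero m]
    (hinv : ∀ g : X ≃ᵢ X, Measure.map g m = m) : m.IsOpenPosMeasure := by
  refine ⟨fun U hU ⟨x, hx⟩ h0 => NeZero.ne m ?_⟩
  obtain ⟨r, hr, hball⟩ := Metric.isOpen_iff.1 hU x hx
  have hx0 : m (Metric.ball x r) = 0 := measure_mono_null hball h0
  have hy0 : ∀ y : X, m (Metric.ball y r) = 0 := fun y => by
    obtain ⟨g, rfl⟩ := hhom x y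
    rw [← hinv g, Measure.map_apply g.continuous.measurable measurableSet_ball,
      g.preimage_ball, g.symm_apply_apply, hx0]
  refine Measure.measure_univ_eq_zero.1 (isCompact_univ.measure_zero_of_nhdsWithin fun y _ => ?_)
  exact ⟨Metric.ball y r, mem_nhdsWithin_of_mem_nhds (Metric.ball_mem_nhds y hr), hy0 y⟩

/-- The average distance from a point does not depend on the point. -/
theorem integral_dist_eq_of_homogeneous {X : Type*} [MetricSpace X]
    [MeasurableSpace X] [BorelSpace X]
    (hhom : ∀ x y : X, ∃ g : X ≃ᵢ X, g x = y)
    (m : Measure X) (hinv : ∀ g : X ≃ᵢ X, Measure.map g m = m) (x y : X) :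
    ∫ z, dist x z ∂m = ∫ z, dist y z ∂m := by
  obtain ⟨g, rfl⟩ := hhom x y
  conv_rhs => rw [← hinv g]
  have hg : MeasurableEmbedding g := g.toHomeomorph.measurableEmbedding
  rw [hg.integral_map]
  simp only [g.dist_eq]

/-- The average distance from any point equals the average distance of the space. -/
theorem integral_dist_eq_integral_prod {X : Type*} [MetricSpace X] [CompactSpace X]
    [MeasurableSpace X] [BorelSpace X]
    (hhom : ∀ x y : X, ∃ g : X ≃ᵢ X, g x = y)
    (m : Measure X) [IsProbabilityMeasure m]
    (hinv : ∀ g : X ≃ᵢ X, Measure.map g m = m) (x : X) :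
    ∫ z, dist x z ∂m = ∫ p : X × X, dist p.1 p.2 ∂(m.prod m) := by
  rw [integral_prod _ (continuous_dist.integrable_of_hasCompactSupport
    (HasCompactSupport.of_compactSpace _))]
  simp [fun y => integral_dist_eq_of_homogeneous hhom m hinv y x]

/-- If a nonempty compact homogeneous metric space of diameter `D` with an
isometry-invariant Borel probability measure `m` has average distance
`A = ∫_{X×X} d(x,y) d(m×m)` equal to `D/2`, then `X` is strictly antipodal:
every `x` has an antipode `Ox` with `d(x,Ox) = D` and
`d(x,y) + d(y,Ox) = D` for all `y`. -/
theorem stmt_11 {X : Type*} [MetricSpace X] [CompactSpace X] [Nonempty X]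
    [MeasurableSpace X] [BorelSpace X]
    (hhom : ∀ x y : X, ∃ g : X ≃ᵢ X, g x = y)
    (m : Measure X) [IsProbabilityMeasure m]
    (hinv : ∀ g : X ≃ᵢ X, Measure.map g m = m)
    (D : ℝ) (hD : D = Metric.diam (Set.univ : Set X))
    (A : ℝ) (hA : A = ∫ p : X × X, dist p.1 p.2 ∂(m.prod m))
    (hAD : A = D / 2) :
    ∀ x : X, ∃ Ox : X, dist x Ox = D ∧ ∀ y : X, dist x y + dist y Ox = D := by
  have := isOpenPosMeasure_of_homogeneous hhom m hinv
  obtain ⟨⟨p, q⟩, -, hmax⟩ := (isCompact_univ (X := X × X)).exists_isMaxOn Set.univ_nonempty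
    continuous_dist.continuousOn
  have hpq : dist p q = D := by
    rw [hD]
    refine le_antisymm (Metric.dist_le_diam_of_mem isCompact_univ.isBounded trivial trivial) ?_
    exact Metric.diam_le_of_forall_dist_le dist_nonneg fun a _ b _ => hmax (Set.mem_univ (a, b))
  have hint : ∀ x : X, Integrable (fun y => dist x y) m := fun x =>
    (by fun_prop : Continuous fun y => dist x y).integrable_of_hasCompactSupport
      (HasCompactSupport.of_compactSpace _)
  have hval : ∀ x : X, ∫ y, dist x y ∂m = D / 2 := fun x => by
    rw [integral_dist_eq_integral_prod hhom m hinv x, ← hA, hAD]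
  have hadd : Integrable (fun y => dist p y + dist q y) m := (hint p).add (hint q)
  have hzero : ∫ y, (dist p y + dist q y - D) ∂m = 0 := by
    rw [integral_sub hadd (integrable_const D),
      integral_add (hint p) (hint q), hval, hval]
    simp
  have hnonneg : ∀ y, 0 ≤ dist p y + dist q y - D := fun y => by
    linarith [dist_triangle_right p q y]
  have hae := (integral_eq_zero_iff_of_nonneg hnonneg
    (hadd.sub (integrable_const D))).1 hzero
  have hall := (Continuous.ae_eq_iff_eq m (by fun_prop) continuous_zero).1 hae
  have hsum : ∀ y, dist p y + dist y q = D := fun y => by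
    have := congrFun hall y
    simp only [Pi.zero_apply] at this
    rw [dist_comm y q]
    linarith
  intro x
  obtain ⟨g, rfl⟩ := hhom p x
  refine ⟨g q, by rw [g.dist_eq, hpq], fun y => ?_⟩
  obtain ⟨z, rfl⟩ := g.surjective y
  rw [g.dist_eq, g.dist_eq, hsum]
end
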